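/- Define, for a pair V = (v_r, v_θ), F₁(V) = ∫_{R₁}^{R₂} ∫_0^{2π} { r(|∂_r v_r|² + |∂_r v_θ|²) + (1/r)[(∂_θ v_r − v_θ)² + (∂_θ v_θ + v_r)²] } dθ dr. Then there exist constants C₁, C₂ > 0 depending only on R₁, R₂ such that for every admissible pair V one has C₁ ‖∇̃V‖_{L²(Ω̃)}² ≤ F₁(V) ≤ C₂ ‖∇̃V‖_{L²(Ω̃)}². -/

import Mathlib

open Real MeasureTheory Set

noncomputable section

/-- Partial derivative in the radial variable. -/
def pdr (f : ℝ → ℝ → ℝ) (r θ : ℝ) : ℝ := deriv (fun x => f x θ) r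

/-- Partial derivative in the angular variable. -/
def pdt (f : ℝ → ℝ → ℝ) (r θ : ℝ) : ℝ := deriv (fun y => f r y) θ

/-- An admissible pair `V = (v_r, v_θ)`: smooth, `2π`-periodic in `θ`,
divergence free (`∂_r (r v_r) + ∂_θ v_θ = 0`), with `v_r` vanishing on both
boundary circles and `v_θ` vanishing on the outer one (the smooth version of
the space `G^{1,2}` of the paper). -/
def Admissible (R₁ R₂ : ℝ) (vr vθ : ℝ → ℝ → ℝ) : Prop :=
  ContDiff ℝ (⊤ : ℕ∞) (fun p : ℝ × ℝ => vr p.1 p.2) ∧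
  ContDiff ℝ (⊤ : ℕ∞) (fun p : ℝ × ℝ => vθ p.1 p.2) ∧
  (∀ r ∈ Icc R₁ R₂, ∀ θ : ℝ, vr r (θ + 2 * π) = vr r θ) ∧
  (∀ r ∈ Icc R₁ R₂, ∀ θ : ℝ, vθ r (θ + 2 * π) = vθ r θ) ∧
  (∀ r ∈ Icc R₁ R₂, ∀ θ : ℝ, deriv (fun x => x * vr x θ) r + pdt vθ r θ = 0) ∧
  (∀ θ : ℝ, vr R₁ θ = 0) ∧ (∀ θ : ℝ, vr R₂ θ = 0) ∧ (∀ θ : ℝ, vθ R₂ θ = 0)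

/-- The squared `L²(Ω̃)` norm of the gradient `∇̃V`. -/
def gradSq (R₁ R₂ : ℝ) (vr vθ : ℝ → ℝ → ℝ) : ℝ :=
  ∫ r in R₁..R₂, ∫ θ in (0:ℝ)..(2 * π),
    ((pdr vr r θ) ^ 2 + (pdt vr r θ) ^ 2 + (pdr vθ r θ) ^ 2 + (pdt vθ r θ) ^ 2)

/-- The functional `F₁(V)` of the paper. -/
def F1 (R₁ R₂ : ℝ) (vr vθ : ℝ → ℝ → ℝ) : ℝ :=
  ∫ r in R₁..R₂, ∫ θ in (0:ℝ)..(2 * π),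
    (r * ((pdr vr r θ) ^ 2 + (pdr vθ r θ) ^ 2) +
      (1 / r) * ((pdt vr r θ - vθ r θ) ^ 2 + (pdt vθ r θ + vr r θ) ^ 2))

/-- The radial derivative of `2 (r - R₁) v ^ 2`. -/
def poincareFlux (R₁ : ℝ) (v : ℝ → ℝ → ℝ) (r θ : ℝ) : ℝ :=
  2 * v r θ ^ 2 + 4 * (r - R₁) * v r θ * pdr v r θ

lemma hasDerivAt_pdr {v : ℝ → ℝ → ℝ} (hv : ContDiff ℝ (⊤ : ℕ∞) (fun p : ℝ × ℝ => v p.1 p.2))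
    (r θ : ℝ) : HasDerivAt (fun x => v x θ) (pdr v r θ) r := by
  have h : ContDiff ℝ (⊤ : ℕ∞) (fun x : ℝ => v x θ) :=
    hv.comp (contDiff_id.prodMk contDiff_const)
  exact (h.differentiable (by simp) r).hasDerivAt

lemma continuous_pdr {v : ℝ → ℝ → ℝ} (hv : ContDiff ℝ (⊤ : ℕ∞) (fun p : ℝ × ℝ => v p.1 p.2)) :
    Continuous (fun p : ℝ × ℝ => pdr v p.1 p.2) := by
  have h : ∀ p : ℝ × ℝ, pdr v p.1 p.2 = fderiv ℝ (fun p : ℝ × ℝ => v p.1 p.2) p (1, 0) := by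
    rintro ⟨r, θ⟩
    exact ((hv.differentiable (by simp) (r, θ)).hasFDerivAt.comp_hasDerivAt r
      ((hasDerivAt_id r).prodMk (hasDerivAt_const r θ))).deriv
  simp_rw [h]
  exact (hv.continuous_fderiv (by simp)).clm_apply continuous_const

lemma continuous_pdt {v : ℝ → ℝ → ℝ} (hv : ContDiff ℝ (⊤ : ℕ∞) (fun p : ℝ × ℝ => v p.1 p.2)) :
    Continuous (fun p : ℝ × ℝ => pdt v p.1 p.2) := by
  have h : ∀ p : ℝ × ℝ, pdt v p.1 p.2 = fderiv ℝ (fun p : ℝ × ℝ => v p.1 p.2) p (0, 1) := by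
    rintro ⟨r, θ⟩
    exact ((hv.differentiable (by simp) (r, θ)).hasFDerivAt.comp_hasDerivAt θ
      ((hasDerivAt_const θ r).prodMk (hasDerivAt_id θ))).deriv
  simp_rw [h]
  exact (hv.continuous_fderiv (by simp)).clm_apply continuous_const

lemma continuous_poincareFlux (R₁ : ℝ) {v : ℝ → ℝ → ℝ}
    (hv : ContDiff ℝ (⊤ : ℕ∞) (fun p : ℝ × ℝ => v p.1 p.2)) :
    Continuous (fun p : ℝ × ℝ => poincareFlux R₁ v p.1 p.2) := by
  have h₁ := continuous_pdr hv
  have h₂ := hv.continuous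
  unfold poincareFlux
  fun_prop

lemma integral_poincareFlux_eq_zero {R₁ R₂ : ℝ} {v : ℝ → ℝ → ℝ}
    (hv : ContDiff ℝ (⊤ : ℕ∞) (fun p : ℝ × ℝ => v p.1 p.2)) (hv₂ : ∀ θ, v R₂ θ = 0) :
    ∫ r in R₁..R₂, ∫ θ in (0 : ℝ)..(2 * π), poincareFlux R₁ v r θ = 0 := by
  have hc := continuous_poincareFlux R₁ hv
  have inner : ∀ θ, ∫ r in R₁..R₂, poincareFlux R₁ v r θ = 0 := by
    intro θ
    have hd : ∀ r, HasDerivAt (fun x => 2 * ((x - R₁) * v x θ ^ 2)) (poincareFlux R₁ v r θ) r := by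
      intro r
      refine ((((hasDerivAt_id r).sub_const R₁).mul
        ((hasDerivAt_pdr hv r θ).pow 2)).const_mul 2).congr_deriv ?_
      simp [poincareFlux]
      ring
    rw [intervalIntegral.integral_eq_sub_of_hasDerivAt (fun r _ => hd r)
      ((hc.comp (Continuous.prodMk_left θ)).intervalIntegrable _ _)]
    simp [hv₂]
  rw [intervalIntegral_intervalIntegral_swap]
  · simp [inner]
  · exact (hc.continuousOn.integrableOn_compact
      (isCompact_uIcc.prod isCompact_uIcc)).mono_set
        (Set.prod_mono uIoc_subset_uIcc uIoc_subset_uIcc)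

lemma sq_le_poincareFlux {R₁ R₂ : ℝ} (v : ℝ → ℝ → ℝ) {r : ℝ} (hr : r ∈ Icc R₁ R₂) (θ : ℝ) :
    v r θ ^ 2 ≤ poincareFlux R₁ v r θ + 4 * (R₂ - R₁) ^ 2 * pdr v r θ ^ 2 := by
  have h : (r - R₁) ^ 2 ≤ (R₂ - R₁) ^ 2 :=
    pow_le_pow_left₀ (sub_nonneg.2 hr.1) (by linarith [hr.2]) 2
  unfold poincareFlux
  nlinarith [sq_nonneg (v r θ + 2 * (r - R₁) * pdr v r θ),
    mul_le_mul_of_nonneg_right h (sq_nonneg (pdr v r θ))]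

/-- Integrating a pointwise bound `f ≤ C g + k (h₁ + h₂)` in which the `hᵢ` have zero integral. -/
lemma integral_le_mul_integral_of_le_add {R₁ R₂ C k : ℝ} (hR : R₁ ≤ R₂)
    {f g h₁ h₂ : ℝ → ℝ → ℝ} (hf : Continuous (fun p : ℝ × ℝ => f p.1 p.2))
    (hg : Continuous (fun p : ℝ × ℝ => g p.1 p.2))
    (hh₁ : Continuous (fun p : ℝ × ℝ => h₁ p.1 p.2))
    (hh₂ : Continuous (fun p : ℝ × ℝ => h₂ p.1 p.2))
    (h₁0 : ∫ r in R₁..R₂, ∫ θ in (0 : ℝ)..(2 * π), h₁ r θ = 0)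
    (h₂0 : ∫ r in R₁..R₂, ∫ θ in (0 : ℝ)..(2 * π), h₂ r θ = 0)
    (hle : ∀ r ∈ Icc R₁ R₂, ∀ θ, f r θ ≤ C * g r θ + k * (h₁ r θ + h₂ r θ)) :
    ∫ r in R₁..R₂, ∫ θ in (0 : ℝ)..(2 * π), f r θ ≤
      C * ∫ r in R₁..R₂, ∫ θ in (0 : ℝ)..(2 * π), g r θ := by
  have slice : ∀ {F : ℝ → ℝ → ℝ}, Continuous (fun p : ℝ × ℝ => F p.1 p.2) →
      ∀ r, IntervalIntegrable (F r) volume 0 (2 * π) := fun hF r =>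
    (hF.comp (Continuous.prodMk_right r)).intervalIntegrable _ _
  have outer : ∀ {F : ℝ → ℝ → ℝ}, Continuous (fun p : ℝ × ℝ => F p.1 p.2) →
      IntervalIntegrable (fun r => ∫ θ in (0 : ℝ)..(2 * π), F r θ) volume R₁ R₂ := fun hF =>
    (intervalIntegral.continuous_parametric_intervalIntegral_of_continuous' hF
      _ _).intervalIntegrable _ _
  calc ∫ r in R₁..R₂, ∫ θ in (0 : ℝ)..(2 * π), f r θ
      ≤ ∫ r in R₁..R₂, (C * (∫ θ in (0 : ℝ)..(2 * π), g r θ) +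
          k * ((∫ θ in (0 : ℝ)..(2 * π), h₁ r θ) + ∫ θ in (0 : ℝ)..(2 * π), h₂ r θ)) := by
        refine intervalIntegral.integral_mono_on hR (outer hf)
          (((outer hg).const_mul C).add (((outer hh₁).add (outer hh₂)).const_mul k))
          fun r hr => ?_
        rw [← intervalIntegral.integral_add (slice hh₁ r) (slice hh₂ r),
          ← intervalIntegral.integral_const_mul, ← intervalIntegral.integral_const_mul,
          ← intervalIntegral.integral_add ((slice hg r).const_mul C)
            (((slice hh₁ r).add (slice hh₂ r)).const_mul k)]
        exact intervalIntegral.integral_mono_on (by positivity) (slice hf r)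
          (((slice hg r).const_mul C).add (((slice hh₁ r).add (slice hh₂ r)).const_mul k))
          fun θ _ => hle r hr θ
    _ = C * ∫ r in R₁..R₂, ∫ θ in (0 : ℝ)..(2 * π), g r θ := by
        rw [intervalIntegral.integral_add ((outer hg).const_mul C)
            (((outer hh₁).add (outer hh₂)).const_mul k),
          intervalIntegral.integral_const_mul, intervalIntegral.integral_const_mul,
          intervalIntegral.integral_add (outer hh₁) (outer hh₂), h₁0, h₂0]
        ring

theorem statement5 (R₁ R₂ : ℝ) (hR₁ : 0 < R₁) (hR₁₂ : R₁ < R₂) :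
    ∃ C₁ C₂ : ℝ, 0 < C₁ ∧ 0 < C₂ ∧
      ∀ vr vθ : ℝ → ℝ → ℝ, Admissible R₁ R₂ vr vθ →
        C₁ * gradSq R₁ R₂ vr vθ ≤ F1 R₁ R₂ vr vθ ∧
        F1 R₁ R₂ vr vθ ≤ C₂ * gradSq R₁ R₂ vr vθ := by
  set K : ℝ := R₂ + 2 / R₁ + 2 / R₁ * (4 * (R₂ - R₁) ^ 2) with hK
  set M : ℝ := (1 + 2 * (4 * (R₂ - R₁) ^ 2)) / R₁ + 2 * R₂ with hM
  have hR₂ : 0 < R₂ := hR₁.trans hR₁₂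
  have hMpos : 0 < M := by positivity
  refine ⟨M⁻¹, K, by positivity, by positivity, ?_⟩
  rintro vr vθ ⟨hvr, hvθ, -, -, -, -, hvr₂, hvθ₂⟩
  let G : ℝ → ℝ → ℝ := fun r θ =>
    (pdr vr r θ) ^ 2 + (pdt vr r θ) ^ 2 + (pdr vθ r θ) ^ 2 + (pdt vθ r θ) ^ 2
  -- The integrand of `F1`, with `r` in the denominator truncated so as to be continuous everywhere.
  let F : ℝ → ℝ → ℝ := fun r θ => r * ((pdr vr r θ) ^ 2 + (pdr vθ r θ) ^ 2) +
      (1 / max r R₁) * ((pdt vr r θ - vθ r θ) ^ 2 + (pdt vθ r θ + vr r θ) ^ 2)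
  have hFI : F1 R₁ R₂ vr vθ = ∫ r in R₁..R₂, ∫ θ in (0 : ℝ)..(2 * π), F r θ := by
    refine intervalIntegral.integral_congr fun r hr => ?_
    rw [uIcc_of_le hR₁₂.le] at hr
    simp only [F, max_eq_left hr.1]
  have cr := hvr.continuous
  have cθ := hvθ.continuous
  have crr := continuous_pdr hvr
  have crt := continuous_pdt hvr
  have cθr := continuous_pdr hvθ
  have cθt := continuous_pdt hvθ
  have hGc : Continuous (fun p : ℝ × ℝ => G p.1 p.2) := by fun_prop
  have hFc : Continuous (fun p : ℝ × ℝ => F p.1 p.2) := by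
    have hmax : Continuous (fun p : ℝ × ℝ => 1 / max p.1 R₁) :=
      continuous_const.div (continuous_fst.max continuous_const)
        fun p => (lt_max_of_lt_right hR₁).ne'
    fun_prop
  have hPr := integral_poincareFlux_eq_zero (R₁ := R₁) hvr hvr₂
  have hPθ := integral_poincareFlux_eq_zero (R₁ := R₁) hvθ hvθ₂
  have hPrc := continuous_poincareFlux R₁ hvr
  have hPθc := continuous_poincareFlux R₁ hvθ
  rw [hFI]
  constructor
  · rw [inv_mul_le_iff₀ hMpos]
    refine integral_le_mul_integral_of_le_add (k := 2) hR₁₂.le hGc hFc hPrc hPθc hPr hPθ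
      fun r hr θ => ?_
    have er := sq_le_poincareFlux vr hr θ
    have eθ := sq_le_poincareFlux vθ hr θ
    have hr0 : 0 < r := hR₁.trans_le hr.1
    simp only [F, max_eq_left hr.1]
    set a := pdr vr r θ
    set b := pdr vθ r θ
    set c := pdt vr r θ
    set d := pdt vθ r θ
    set x := vr r θ
    set y := vθ r θ
    have hA : (1 + 2 * (4 * (R₂ - R₁) ^ 2)) * (a ^ 2 + b ^ 2) ≤
        (1 + 2 * (4 * (R₂ - R₁) ^ 2)) / R₁ * (r * (a ^ 2 + b ^ 2)) := by
      rw [div_mul_eq_mul_div, le_div_iff₀ hR₁, mul_assoc, mul_comm _ R₁]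
      gcongr
      exact hr.1
    have hB : 2 * ((c - y) ^ 2 + (d + x) ^ 2) ≤
        2 * R₂ * (1 / r * ((c - y) ^ 2 + (d + x) ^ 2)) := by
      rw [mul_assoc]
      gcongr
      rw [← mul_assoc, mul_one_div]
      exact le_mul_of_one_le_left (by positivity) ((one_le_div hr0).2 hr.2)
    have hC : 0 ≤ (1 + 2 * (4 * (R₂ - R₁) ^ 2)) / R₁ *
        (1 / r * ((c - y) ^ 2 + (d + x) ^ 2)) := by positivity
    have hD : 0 ≤ 2 * R₂ * (r * (a ^ 2 + b ^ 2)) := by positivity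
    rw [hM]
    linarith [sq_nonneg (c - 2 * y), sq_nonneg (d + 2 * x)]
  · refine integral_le_mul_integral_of_le_add (k := 2 / R₁) hR₁₂.le hFc hGc hPrc hPθc hPr hPθ
      fun r hr θ => ?_
    have er := sq_le_poincareFlux vr hr θ
    have eθ := sq_le_poincareFlux vθ hr θ
    have hr0 : 0 < r := hR₁.trans_le hr.1
    simp only [F, max_eq_left hr.1]
    set a := pdr vr r θ
    set b := pdr vθ r θ
    set c := pdt vr r θ
    set d := pdt vθ r θ
    set x := vr r θ
    set y := vθ r θ
    have hA : r * (a ^ 2 + b ^ 2) ≤ R₂ * (a ^ 2 + b ^ 2) := by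
      gcongr
      exact hr.2
    have hB : 1 / r * ((c - y) ^ 2 + (d + x) ^ 2) ≤
        2 / R₁ * (c ^ 2 + d ^ 2 + x ^ 2 + y ^ 2) := by
      have h₁ : 1 / r ≤ 1 / R₁ := one_div_le_one_div_of_le hR₁ hr.1
      calc 1 / r * ((c - y) ^ 2 + (d + x) ^ 2)
          ≤ 1 / R₁ * (2 * (c ^ 2 + d ^ 2 + x ^ 2 + y ^ 2)) := by
            gcongr
            linarith [sq_nonneg (c + y), sq_nonneg (d - x)]
        _ = _ := by ring
    have hC := mul_le_mul_of_nonneg_left (add_le_add er eθ) (by positivity : 0 ≤ 2 / R₁)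
    have hD : 0 ≤ R₂ * (c ^ 2 + d ^ 2) := by positivity
    have hE : 0 ≤ 2 / R₁ * (a ^ 2 + b ^ 2) := by positivity
    have hL : 0 ≤ 2 / R₁ * (4 * (R₂ - R₁) ^ 2) * (c ^ 2 + d ^ 2) := by positivity
    rw [hK]
    linarith

end
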